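/- arXiv:2402.02434 — 6 statements merged into one kernel-verified Lean document; each statement's English description precedes it below -/
import Mathlib

section
/- Let t₀ > 0 and let q₀ : ℤ → ℂ satisfy |q₀(n)| < 1 for all n. Suppose q and q̃ both solve the Ablowitz–Ladik equation on [0,t₀] with the same initial datum q₀ (i.e., q(0,n) = q̃(0,n) = q₀(n) for all n, and for each n the maps t ↦ q(t,n) and t ↦ q̃(t,n) are differentiable on [0,t₀] and satisfy the AL equation). Then q(t,n) = q̃(t,n) for all t ∈ [0,t₀] and n ∈ ℤ. -/
open Complex Metric Finset Filter

noncomputable section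

/-- The right-hand side of the Ablowitz–Ladik equation:
`i·(1 − |q(t,n)|²)·(q(t,n−1) + q(t,n+1))`. -/
def ALDeriv (q : ℝ → ℤ → ℂ) (t : ℝ) (n : ℤ) : ℂ :=
  Complex.I * ((1 - ‖q t n‖ ^ 2 : ℝ) : ℂ) * (q t (n - 1) + q t (n + 1))

theorem AL_norm_le_one (t₀ : ℝ) (q : ℝ → ℤ → ℂ) (h0 : ∀ n : ℤ, ‖q 0 n‖ < 1)
    (hq : ∀ (n : ℤ), ∀ t ∈ Set.Icc (0 : ℝ) t₀,
      HasDerivWithinAt (fun s => q s n) (ALDeriv q t n) (Set.Icc (0 : ℝ) t₀) t)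
    (n : ℤ) (t : ℝ) (ht : t ∈ Set.Icc (0 : ℝ) t₀) : ‖q t n‖ ≤ 1 := by
  have hc : ∀ m : ℤ, ContinuousOn (fun s => q s m) (Set.Icc 0 t₀) :=
    fun m s hs => (hq m s hs).continuousWithinAt
  let g : ℝ → ℝ := fun s => -2 * inner ℝ (q s n) (Complex.I * (q s (n - 1) + q s (n + 1)))
  have hg : ContinuousOn g (Set.Icc 0 t₀) :=
    continuousOn_const.mul (ContinuousOn.inner (𝕜 := ℝ) (hc n) (continuousOn_const.mul ((hc (n - 1)).add (hc (n + 1)))))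
  obtain ⟨M, hM⟩ := isCompact_Icc.exists_bound_of_continuousOn hg
  let u : ℝ → ℝ := fun s => 1 - ‖q s n‖ ^ 2
  have hu : ∀ s ∈ Set.Icc 0 t₀, HasDerivWithinAt u (u s * g s) (Set.Icc 0 t₀) s := by
    intro s hs
    have h := ((hq n s hs).norm_sq).const_sub 1
    refine h.congr_deriv ?_
    have e : ALDeriv q s n = (u s) • (Complex.I * (q s (n - 1) + q s (n + 1))) := by
      simp only [ALDeriv, u, Complex.real_smul]; ring
    rw [e, inner_smul_right]
    simp only [g]; simp; ring
  have huc : ContinuousOn u (Set.Icc 0 t₀) := fun s hs => (hu s hs).continuousWithinAt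
  let w : ℝ → ℝ := fun s => u s ^ 2 * Real.exp (2 * M * s)
  have hw : ∀ s ∈ Set.Icc 0 t₀, HasDerivWithinAt w
      (2 * u s ^ 2 * (g s + M) * Real.exp (2 * M * s)) (Set.Icc 0 t₀) s := by
    intro s hs
    have h1 := (hu s hs).pow 2
    have h2 : HasDerivAt (fun s : ℝ => Real.exp (2 * M * s)) (Real.exp (2 * M * s) * (2 * M)) s := by
      have := ((hasDerivAt_id s).const_mul (2 * M)).exp
      simpa using this
    refine (h1.mul h2.hasDerivWithinAt).congr_deriv ?_
    simp; ring
  have hmono : MonotoneOn w (Set.Icc 0 t₀) := by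
    refine monotoneOn_of_hasDerivWithinAt_nonneg (convex_Icc 0 t₀)
      (fun s hs => (hw s hs).continuousWithinAt)
      (fun s hs => (hw s (interior_subset hs)).mono interior_subset) ?_
    intro s hs
    have := hM s (interior_subset hs)
    rw [Real.norm_eq_abs] at this
    have := neg_le_of_abs_le this
    have : 0 ≤ g s + M := by linarith
    positivity
  have hu0 : 0 < u 0 := by
    have := h0 n
    have h' := norm_nonneg (q 0 n)
    simp only [u]; nlinarith
  have hne : ∀ s ∈ Set.Icc 0 t₀, u s ≠ 0 := by
    intro s hs h
    have := hmono ⟨le_rfl, hs.1.trans hs.2⟩ hs hs.1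
    simp only [w, h] at this
    simp at this
    nlinarith
  have hpos : 0 ≤ u t := by
    by_contra! hneg
    have hsub : Set.Icc 0 t ⊆ Set.Icc 0 t₀ := Set.Icc_subset_Icc_right ht.2
    obtain ⟨s, hs, hs0⟩ := intermediate_value_Icc' ht.1 (huc.mono hsub) ⟨hneg.le, hu0.le⟩
    exact hne s (hsub hs) hs0
  simp only [u] at hpos
  have h' := norm_nonneg (q t n)
  nlinarith

theorem AL_lip (a b c a' b' c' : ℂ) (ha : ‖a‖ ≤ 1) (hb : ‖b‖ ≤ 1) (hc : ‖c‖ ≤ 1)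
    (ha' : ‖a'‖ ≤ 1) :
    ‖Complex.I * ((1 - ‖a‖ ^ 2 : ℝ) : ℂ) * (b + c) - Complex.I * ((1 - ‖a'‖ ^ 2 : ℝ) : ℂ) * (b' + c')‖
      ≤ 4 * ‖a - a'‖ + ‖b - b'‖ + ‖c - c'‖ := by
  have e : Complex.I * ((1 - ‖a‖ ^ 2 : ℝ) : ℂ) * (b + c)
        - Complex.I * ((1 - ‖a'‖ ^ 2 : ℝ) : ℂ) * (b' + c')
      = Complex.I * (((‖a'‖ ^ 2 - ‖a‖ ^ 2 : ℝ) : ℂ) * (b + c)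
        + ((1 - ‖a'‖ ^ 2 : ℝ) : ℂ) * ((b - b') + (c - c'))) := by
    push_cast; ring
  rw [e, norm_mul, Complex.norm_I, one_mul]
  refine (norm_add_le _ _).trans ?_
  rw [norm_mul, norm_mul, Complex.norm_real, Complex.norm_real, Real.norm_eq_abs, Real.norm_eq_abs]
  have h1 : |‖a'‖ ^ 2 - ‖a‖ ^ 2| ≤ 2 * ‖a - a'‖ := by
    have e2 : ‖a'‖ ^ 2 - ‖a‖ ^ 2 = (‖a'‖ + ‖a‖) * (‖a'‖ - ‖a‖) := by ring
    rw [e2, abs_mul, abs_of_nonneg (by positivity)]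
    have := abs_norm_sub_norm_le a' a
    rw [norm_sub_rev] at this
    exact mul_le_mul (by linarith) this (abs_nonneg _) (by norm_num)
  have h2 : |1 - ‖a'‖ ^ 2| ≤ 1 := by
    have := norm_nonneg a'
    rw [abs_le]; constructor <;> nlinarith
  have h3 : ‖b + c‖ ≤ 2 := (norm_add_le _ _).trans (by linarith)
  have h4 := norm_add_le (b - b') (c - c')
  have h5 := mul_le_mul h1 h3 (norm_nonneg _) (by positivity)
  have h6 := mul_le_mul h2 h4 (norm_nonneg _) (by positivity)
  linarith

theorem stmt12 (t₀ : ℝ) (ht₀ : 0 < t₀) (q0 : ℤ → ℂ) (hq0 : ∀ n : ℤ, ‖q0 n‖ < 1)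
    (q q' : ℝ → ℤ → ℂ)
    (hqi : ∀ n : ℤ, q 0 n = q0 n) (hqi' : ∀ n : ℤ, q' 0 n = q0 n)
    (hq : ∀ (n : ℤ), ∀ t ∈ Set.Icc (0 : ℝ) t₀,
      HasDerivWithinAt (fun s => q s n) (ALDeriv q t n) (Set.Icc (0 : ℝ) t₀) t)
    (hq' : ∀ (n : ℤ), ∀ t ∈ Set.Icc (0 : ℝ) t₀,
      HasDerivWithinAt (fun s => q' s n) (ALDeriv q' t n) (Set.Icc (0 : ℝ) t₀) t) :
    ∀ t ∈ Set.Icc (0 : ℝ) t₀, ∀ n : ℤ, q t n = q' t n := by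
  have hB := AL_norm_le_one t₀ q (fun n => by rw [hqi]; exact hq0 n) hq
  have hB' := AL_norm_le_one t₀ q' (fun n => by rw [hqi']; exact hq0 n) hq'
  have key : ∀ k : ℕ, ∀ n : ℤ, ∀ t ∈ Set.Icc (0 : ℝ) t₀,
      ‖q t n - q' t n‖ ≤ 2 * ((6 * t) ^ k / (k.factorial : ℝ)) := by
    intro k
    induction k with
    | zero =>
      intro n t ht
      have := norm_sub_le (q t n) (q' t n)
      have := hB n t ht
      have := hB' n t ht
      simp; linarith
    | succ k ih =>
      intro n
      have hd : ∀ t ∈ Set.Icc (0 : ℝ) t₀, HasDerivWithinAt (fun s => q s n - q' s n)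
          (ALDeriv q t n - ALDeriv q' t n) (Set.Icc (0 : ℝ) t₀) t :=
        fun t ht => (hq n t ht).sub (hq' n t ht)
      refine fun t ht => image_norm_le_of_norm_deriv_right_le_deriv_boundary
        (f := fun s => q s n - q' s n) (f' := fun t => ALDeriv q t n - ALDeriv q' t n)
        (B := fun t => 2 * ((6 * t) ^ (k + 1) / ((k + 1).factorial : ℝ)))
        (B' := fun t => 6 * (2 * ((6 * t) ^ k / (k.factorial : ℝ))))
        (fun s hs => (hd s hs).continuousWithinAt)
        (fun s hs => (hd s ⟨hs.1, hs.2.le⟩).mono_of_mem_nhdsWithin (Icc_mem_nhdsGE_of_mem hs))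
        ?_ ?_ ?_ ht
      · simp [hqi, hqi']
      · intro x
        have h := ((((hasDerivAt_id x).const_mul 6).pow (k + 1)).div_const
          ((k + 1).factorial : ℝ)).const_mul 2
        refine h.congr_deriv ?_
        have : (k.factorial : ℝ) ≠ 0 := by positivity
        have : (k : ℝ) + 1 ≠ 0 := by positivity
        rw [Nat.factorial_succ]
        push_cast
        simp only [id, Nat.add_sub_cancel]
        field_simp
      · intro s hs
        have hs' : s ∈ Set.Icc (0 : ℝ) t₀ := ⟨hs.1, hs.2.le⟩
        have h := AL_lip (q s n) (q s (n - 1)) (q s (n + 1)) (q' s n) (q' s (n - 1)) (q' s (n + 1))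
          (hB _ s hs') (hB _ s hs') (hB _ s hs') (hB' _ s hs')
        have h1 := ih n s hs'
        have h2 := ih (n - 1) s hs'
        have h3 := ih (n + 1) s hs'
        refine h.trans ?_
        linarith
  intro t ht n
  have hlim : Tendsto (fun k : ℕ => 2 * ((6 * t) ^ k / (k.factorial : ℝ))) atTop (nhds (2 * 0)) :=
    (FloorSemiring.tendsto_pow_div_factorial_atTop (6 * t)).const_mul 2
  have h := ge_of_tendsto' hlim (fun k => key k n t ht)
  rw [mul_zero] at h
  exact sub_eq_zero.mp (norm_le_zero_iff.mp h)
end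
end

section
/- For every q₀ : ℤ → ℂ with |q₀(n)| < 1 for all n ∈ ℤ, there exists a unique function q : ℝ × ℤ → ℂ such that: q(0,n) = q₀(n) for all n; for each n ∈ ℤ the map t ↦ q(t,n) is differentiable on ℝ with derivative ∂q/∂t(t,n) = i·(1 − |q(t,n)|²)·(q(t,n−1) + q(t,n+1)); and |q(t,n)| < 1 for all t ∈ ℝ and n ∈ ℤ. -/
open Complex Metric Finset Filter

noncomputable section

/-- clamp of a real to `[-1,1]`. -/
def ALclamp (x : ℝ) : ℝ := max (-1) (min 1 x)

lemma ALclamp_abs (x : ℝ) : |ALclamp x| ≤ 1 := by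
  unfold ALclamp
  rw [abs_le]
  exact ⟨le_max_left _ _, max_le (by norm_num) (min_le_left _ _)⟩

lemma ALclamp_sub (x y : ℝ) : |ALclamp x - ALclamp y| ≤ |x - y| := by
  unfold ALclamp
  grind

lemma ALclamp_eq (x : ℝ) (h : |x| ≤ 1) : ALclamp x = x := by
  unfold ALclamp
  rw [abs_le] at h
  rw [min_eq_right h.2, max_eq_right h.1]

/-- coordinatewise clamp of a complex number. -/
def ALrho (z : ℂ) : ℂ := ⟨ALclamp z.re, ALclamp z.im⟩

lemma ALrho_norm (z : ℂ) : ‖ALrho z‖ ≤ 2 := by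
  have h := Complex.norm_le_abs_re_add_abs_im (ALrho z)
  have h1 := ALclamp_abs z.re
  have h2 := ALclamp_abs z.im
  simp only [ALrho] at h ⊢
  linarith

lemma ALrho_sub (z w : ℂ) : ‖ALrho z - ALrho w‖ ≤ 2 * ‖z - w‖ := by
  have h := Complex.norm_le_abs_re_add_abs_im (ALrho z - ALrho w)
  have h1 := ALclamp_sub z.re w.re
  have h2 := ALclamp_sub z.im w.im
  have h3 := Complex.abs_re_le_norm (z - w)
  have h4 := Complex.abs_im_le_norm (z - w)
  simp only [ALrho, Complex.sub_re, Complex.sub_im] at h h3 h4 ⊢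
  linarith

lemma ALrho_eq (z : ℂ) (h : ‖z‖ < 1) : ALrho z = z := by
  have h3 := Complex.abs_re_le_norm z
  have h4 := Complex.abs_im_le_norm z
  apply Complex.ext
  · exact ALclamp_eq _ (by linarith)
  · exact ALclamp_eq _ (by linarith)

/-- truncated factor. -/
def ALphi (z : ℂ) : ℝ := 1 - (min ‖z‖ 1) ^ 2

lemma ALphi_abs (z : ℂ) : |ALphi z| ≤ 1 := by
  unfold ALphi
  have h0 : 0 ≤ min ‖z‖ 1 := le_min (norm_nonneg _) zero_le_one
  have h1 : min ‖z‖ 1 ≤ 1 := min_le_right _ _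
  rw [abs_le]; constructor <;> nlinarith

lemma ALphi_sub (z w : ℂ) : |ALphi z - ALphi w| ≤ 2 * ‖z - w‖ := by
  have hz0 : 0 ≤ min ‖z‖ 1 := le_min (norm_nonneg _) zero_le_one
  have hz1 : min ‖z‖ 1 ≤ 1 := min_le_right _ _
  have hw0 : 0 ≤ min ‖w‖ 1 := le_min (norm_nonneg _) zero_le_one
  have hw1 : min ‖w‖ 1 ≤ 1 := min_le_right _ _
  have h : |min ‖w‖ 1 - min ‖z‖ 1| ≤ ‖z - w‖ := by
    refine le_trans ?_ (abs_norm_sub_norm_le z w)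
    grind
  have : ALphi z - ALphi w = (min ‖w‖ 1 + min ‖z‖ 1) * (min ‖w‖ 1 - min ‖z‖ 1) := by
    unfold ALphi; ring
  rw [this, abs_mul, abs_of_nonneg (by linarith)]
  exact mul_le_mul (by linarith) h (abs_nonneg _) (by norm_num)

lemma ALphi_eq (z : ℂ) (h : ‖z‖ < 1) : ALphi z = 1 - ‖z‖ ^ 2 := by
  unfold ALphi; rw [min_eq_left h.le]

lemma ALphi_zero (z : ℂ) (h : 1 ≤ ‖z‖) : ALphi z = 0 := by
  unfold ALphi; rw [min_eq_right h]; norm_num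

/-- truncated right-hand side. -/
def ALG (x a b : ℂ) : ℂ := Complex.I * (ALphi x : ℂ) * (ALrho a + ALrho b)

lemma ALrho_add_norm (a b : ℂ) : ‖ALrho a + ALrho b‖ ≤ 4 := by
  have := norm_add_le (ALrho a) (ALrho b)
  linarith [ALrho_norm a, ALrho_norm b]

lemma ALG_norm (x a b : ℂ) : ‖ALG x a b‖ ≤ 4 := by
  unfold ALG
  rw [norm_mul, norm_mul, Complex.norm_I, one_mul, Complex.norm_real, Real.norm_eq_abs]
  calc |ALphi x| * ‖ALrho a + ALrho b‖ ≤ 1 * 4 :=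
        mul_le_mul (ALphi_abs x) (ALrho_add_norm a b) (norm_nonneg _) (by norm_num)
    _ = 4 := by norm_num

lemma ALG_sub (x a b x' a' b' : ℂ) (B : ℝ) (hx : ‖x - x'‖ ≤ B) (ha : ‖a - a'‖ ≤ B)
    (hb : ‖b - b'‖ ≤ B) : ‖ALG x a b - ALG x' a' b'‖ ≤ 12 * B := by
  have key : ALG x a b - ALG x' a' b' =
      Complex.I * (((ALphi x - ALphi x' : ℝ) : ℂ) * (ALrho a + ALrho b)
        + (ALphi x' : ℂ) * ((ALrho a - ALrho a') + (ALrho b - ALrho b'))) := by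
    unfold ALG; push_cast; ring
  rw [key, norm_mul, Complex.norm_I, one_mul]
  refine (norm_add_le _ _).trans ?_
  rw [norm_mul, norm_mul, Complex.norm_real, Complex.norm_real, Real.norm_eq_abs,
    Real.norm_eq_abs]
  have h1 : |ALphi x - ALphi x'| * ‖ALrho a + ALrho b‖ ≤ (2 * B) * 4 :=
    mul_le_mul ((ALphi_sub x x').trans (by linarith)) (ALrho_add_norm a b) (norm_nonneg _)
      (by linarith [norm_nonneg (x - x')])
  have h2 : ‖(ALrho a - ALrho a') + (ALrho b - ALrho b')‖ ≤ 4 * B := by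
    have := norm_add_le (ALrho a - ALrho a') (ALrho b - ALrho b')
    linarith [ALrho_sub a a', ALrho_sub b b']
  have h3 : |ALphi x'| * ‖(ALrho a - ALrho a') + (ALrho b - ALrho b')‖ ≤ 1 * (4 * B) :=
    mul_le_mul (ALphi_abs x') h2 (norm_nonneg _) (by norm_num)
  linarith

lemma ALDeriv_eq (q : ℝ → ℤ → ℂ) (hq : ∀ t n, ‖q t n‖ < 1) (t : ℝ) (n : ℤ) :
    ALDeriv q t n = ALG (q t n) (q t (n - 1)) (q t (n + 1)) := by
  unfold ALDeriv ALG
  rw [ALphi_eq _ (hq _ _), ALrho_eq _ (hq _ _), ALrho_eq _ (hq _ _)]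

/-! Uniqueness -/

lemma AL_iter (d d' : ℝ → ℤ → ℂ) (h0 : ∀ n, d 0 n = 0)
    (hd : ∀ t n, HasDerivAt (fun s => d s n) (d' t n) t) (hb : ∀ t n, ‖d t n‖ ≤ 2)
    (hd' : ∀ t B, (∀ n, ‖d t n‖ ≤ B) → ∀ n, ‖d' t n‖ ≤ 12 * B) (k : ℕ) :
    ∀ t, 0 ≤ t → ∀ n, ‖d t n‖ ≤ 2 * ((12 * t) ^ k / (k.factorial : ℝ)) := by
  induction k with
  | zero => intro t _ n; simpa using hb t n
  | succ k ih =>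
    intro t ht n
    have hk : ((k.factorial : ℕ) : ℝ) ≠ 0 := by positivity
    refine image_norm_le_of_norm_deriv_right_le_deriv_boundary
      (f := fun s => d s n) (f' := fun s => d' s n) (a := 0) (b := t)
      (B := fun s => 2 * ((12 * s) ^ (k + 1) / ((k + 1).factorial : ℝ)))
      (B' := fun s => 12 * (2 * ((12 * s) ^ k / (k.factorial : ℝ))))
      (fun s _ => (hd s n).continuousAt.continuousWithinAt)
      (fun s _ => (hd s n).hasDerivWithinAt) ?_ ?_ ?_ ⟨ht, le_rfl⟩
    · simp [h0]
    · intro s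
      have h := (((((hasDerivAt_id s).const_mul (12 : ℝ)).pow (k + 1)).div_const
        ((k + 1).factorial : ℝ)).const_mul 2)
      refine h.congr_deriv ?_
      rw [Nat.factorial_succ]
      push_cast
      have : ((k : ℝ) + 1) ≠ 0 := by positivity
      simp only [id, add_tsub_cancel_right]
      field_simp
    · intro s hs
      exact hd' s _ (ih s hs.1) n

lemma AL_zero_right (d d' : ℝ → ℤ → ℂ) (h0 : ∀ n, d 0 n = 0)
    (hd : ∀ t n, HasDerivAt (fun s => d s n) (d' t n) t) (hb : ∀ t n, ‖d t n‖ ≤ 2)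
    (hd' : ∀ t B, (∀ n, ‖d t n‖ ≤ B) → ∀ n, ‖d' t n‖ ≤ 12 * B) (t : ℝ) (ht : 0 ≤ t) (n : ℤ) :
    d t n = 0 := by
  have h := (FloorSemiring.tendsto_pow_div_factorial_atTop (12 * t)).const_mul 2
  have h2 : ‖d t n‖ ≤ 2 * 0 :=
    ge_of_tendsto' h (fun k => AL_iter d d' h0 hd hb hd' k t ht n)
  rw [mul_zero] at h2
  exact norm_le_zero_iff.mp h2

lemma AL_zero (d d' : ℝ → ℤ → ℂ) (h0 : ∀ n, d 0 n = 0)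
    (hd : ∀ t n, HasDerivAt (fun s => d s n) (d' t n) t) (hb : ∀ t n, ‖d t n‖ ≤ 2)
    (hd' : ∀ t B, (∀ n, ‖d t n‖ ≤ B) → ∀ n, ‖d' t n‖ ≤ 12 * B) (t : ℝ) (n : ℤ) :
    d t n = 0 := by
  rcases le_total 0 t with ht | ht
  · exact AL_zero_right d d' h0 hd hb hd' t ht n
  · have := AL_zero_right (fun s => d (-s)) (fun s n => -(d' (-s) n)) (by simpa using h0)
      (fun s n => by
        have h := (hd (-s) n).scomp s (hasDerivAt_neg s)
        simpa [Function.comp_def] using h)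
      (fun s n => hb _ _) (fun s B h n => by simpa using hd' (-s) B h n) (-t) (by linarith) n
    simpa using this

/-! Existence -/

/-- The Banach space of bounded sequences. -/
abbrev ALE := BoundedContinuousFunction ℤ ℂ

/-- The truncated vector field. -/
def ALF (x : ALE) : ALE :=
  BoundedContinuousFunction.ofNormedAddCommGroupDiscrete
    (fun n => ALG (x n) (x (n - 1)) (x (n + 1))) 4 (fun _ => ALG_norm _ _ _)

lemma ALF_apply (x : ALE) (n : ℤ) : ALF x n = ALG (x n) (x (n - 1)) (x (n + 1)) := rfl

lemma ALF_norm (x : ALE) : ‖ALF x‖ ≤ 4 :=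
  (BoundedContinuousFunction.norm_le (by norm_num)).2 (fun _ => ALG_norm _ _ _)

lemma ALF_lip : LipschitzWith 12 ALF := by
  refine LipschitzWith.of_dist_le_mul (fun x y => ?_)
  refine (BoundedContinuousFunction.dist_le (by positivity)).2 (fun n => ?_)
  rw [dist_eq_norm, ALF_apply, ALF_apply]
  have h : ∀ m, ‖x m - y m‖ ≤ dist x y := fun m => by
    rw [← dist_eq_norm]; exact BoundedContinuousFunction.dist_coe_le_dist m
  exact ALG_sub _ _ _ _ _ _ _ (h _) (h _) (h _)

lemma ALF_local (x₀ : ALE) (N : ℕ) : ∃ α : ℝ → ALE, α 0 = x₀ ∧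
    ∀ t ∈ Set.Ioo (-(N : ℝ)) N, HasDerivAt α (ALF (α t)) t := by
  have hN : (0 : ℝ) ≤ N := Nat.cast_nonneg N
  have hp : IsPicardLindelof (fun _ : ℝ => ALF) (tmin := -(N : ℝ)) (tmax := N)
      ⟨0, by simp, hN⟩ x₀ (4 * N) 0 4 12 := by
    refine ⟨fun t _ => ALF_lip.lipschitzOnWith, fun x _ => continuousOn_const,
      fun t _ x _ => ALF_norm x, ?_⟩
    simp
  obtain ⟨α, h0, h⟩ := hp.exists_eq_forall_mem_Icc_hasDerivWithinAt₀
  exact ⟨α, h0, fun t ht => (h t (Set.Ioo_subset_Icc_self ht)).hasDerivAt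
    (Icc_mem_nhds ht.1 ht.2)⟩

lemma ALF_global (x₀ : ALE) : ∃ α : ℝ → ALE, α 0 = x₀ ∧
    ∀ t, HasDerivAt α (ALF (α t)) t := by
  choose α h0 h using ALF_local x₀
  have hag : ∀ M N : ℕ, M ≤ N → ∀ t ∈ Set.Ioo (-(M : ℝ)) M, α M t = α N t := by
    intro M N hMN t ht
    have hMN' : (M : ℝ) ≤ N := by exact_mod_cast hMN
    have hM : (0 : ℝ) < M := by linarith [ht.1, ht.2]
    exact ODE_solution_unique_of_mem_Ioo (v := fun _ => ALF) (s := fun _ => Set.univ)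
      (t₀ := 0) (K := 12) (fun _ _ => ALF_lip.lipschitzOnWith) ⟨by linarith, hM⟩
      (fun s hs => ⟨h M s hs, trivial⟩)
      (fun s hs => ⟨h N s ⟨by linarith [hs.1], by linarith [hs.2]⟩, trivial⟩)
      (by rw [h0, h0]) ht
  have hfl : ∀ t : ℝ, t ∈ Set.Ioo (-((⌊|t|⌋₊ + 1 : ℕ) : ℝ)) ((⌊|t|⌋₊ + 1 : ℕ) : ℝ) := by
    intro t
    have := Nat.lt_floor_add_one |t|
    have h1 := neg_abs_le t
    have h2 := le_abs_self t
    push_cast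
    exact ⟨by linarith, by linarith⟩
  have hag' : ∀ M : ℕ, ∀ t ∈ Set.Ioo (-(M : ℝ)) M, α (⌊|t|⌋₊ + 1) t = α M t := by
    intro M t ht
    rcases le_total M (⌊|t|⌋₊ + 1) with hle | hle
    · exact (hag _ _ hle t ht).symm
    · exact hag _ _ hle t (hfl t)
  refine ⟨fun t => α (⌊|t|⌋₊ + 1) t, h0 _, fun t => ?_⟩
  refine (h _ t (hfl t)).congr_of_eventuallyEq ?_
  filter_upwards [Ioo_mem_nhds (hfl t).1 (hfl t).2] with s hs
  exact hag' _ s hs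

lemma AL_bound (S : ℝ → ℂ) (hS : ∀ t, ‖S t‖ ≤ 4) (f : ℝ → ℂ) (h0 : ‖f 0‖ < 1)
    (hf : ∀ t, HasDerivAt f (Complex.I * (ALphi (f t) : ℂ) * S t) t) (t : ℝ) : ‖f t‖ < 1 := by
  by_contra hcon
  push Not at hcon
  have hlip : ∀ s, LipschitzWith 8 (fun x : ℂ => Complex.I * (ALphi x : ℂ) * S s) := by
    intro s
    refine LipschitzWith.of_dist_le_mul (fun x y => ?_)
    rw [dist_eq_norm, dist_eq_norm, ← sub_mul, ← mul_sub, ← Complex.ofReal_sub, norm_mul,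
      norm_mul, Complex.norm_I, one_mul, Complex.norm_real, Real.norm_eq_abs]
    have := mul_le_mul (ALphi_sub x y) (hS s) (norm_nonneg _) (by positivity)
    have e : ((8 : NNReal) : ℝ) = 8 := rfl
    rw [e]; linarith
  have heq : f = fun _ => f t :=
    ODE_solution_unique_univ (v := fun s x => Complex.I * (ALphi x : ℂ) * S s)
      (s := fun _ => Set.univ) (t₀ := t) (fun s => (hlip s).lipschitzOnWith)
      (fun s => ⟨hf s, trivial⟩)
      (fun s => ⟨by simpa [ALphi_zero _ hcon] using hasDerivAt_const s (f t), trivial⟩) rfl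
  have := congrFun heq 0
  rw [this] at h0
  linarith

theorem stmt13 (q0 : ℤ → ℂ) (hq0 : ∀ n : ℤ, ‖q0 n‖ < 1) :
    ∃! q : ℝ → ℤ → ℂ,
      (∀ n : ℤ, q 0 n = q0 n) ∧
      (∀ (t : ℝ) (n : ℤ), HasDerivAt (fun s => q s n) (ALDeriv q t n) t) ∧
      (∀ (t : ℝ) (n : ℤ), ‖q t n‖ < 1) := by
  obtain ⟨α, h0, hα⟩ := ALF_global
    (BoundedContinuousFunction.ofNormedAddCommGroupDiscrete q0 1 (fun n => (hq0 n).le))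
  have h0' : ∀ n, α 0 n = q0 n := fun n => by rw [h0]; rfl
  have hd : ∀ (t : ℝ) (n : ℤ), HasDerivAt (fun s => α s n)
      (ALG (α t n) (α t (n - 1)) (α t (n + 1))) t := by
    intro t n
    exact (BoundedContinuousFunction.evalCLM ℝ n : ALE →L[ℝ] ℂ).hasFDerivAt.comp_hasDerivAt t
      (hα t)
  have hb : ∀ (t : ℝ) (n : ℤ), ‖α t n‖ < 1 := fun t n =>
    AL_bound (fun s => ALrho (α s (n - 1)) + ALrho (α s (n + 1)))
      (fun s => ALrho_add_norm _ _) (fun s => α s n) (by simpa [h0'] using hq0 n)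
      (fun s => hd s n) t
  refine ⟨fun t n => α t n, ⟨h0', fun t n => ?_, hb⟩, ?_⟩
  · rw [ALDeriv_eq _ hb]; exact hd t n
  · rintro p ⟨hp0, hpd, hpb⟩
    funext t n
    refine sub_eq_zero.mp (AL_zero (fun t n => p t n - α t n)
      (fun t n => ALG (p t n) (p t (n - 1)) (p t (n + 1)) -
        ALG (α t n) (α t (n - 1)) (α t (n + 1))) ?_ ?_ ?_ ?_ t n)
    · intro n; simp [hp0, h0']
    · intro t n
      have := hpd t n
      rw [ALDeriv_eq _ hpb] at this
      exact this.sub (hd t n)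
    · intro t n
      have := norm_sub_le (p t n) (α t n)
      linarith [hpb t n, hb t n]
    · intro t B hB n
      exact ALG_sub _ _ _ _ _ _ _ (hB _) (hB _) (hB _)
end
end

section
/- Let q₀ : ℤ → ℂ satisfy |q₀(n)| < 1 for all n, fix N ∈ ℕ, and let q₀,N be the truncated datum: q₀,N(n) = q₀(n) for |n| ≤ N and q₀,N(n) = 0 for |n| > N. Let q and q_N solve the Ablowitz–Ladik equation on [0,∞) with initial data q₀ and q₀,N respectively, with |q(s,m)| ≤ 1 and |q_N(s,m)| ≤ 1 for all s ≥ 0, m ∈ ℤ. Then for every j ∈ ℤ with N ≥ |j|, every t > 0 and every r ∈ (0,1): |q(t,j) − q_N(t,j)| ≤ (√2 · r · e^{10t/r²} / √(1 − r²)) · r^{N−|j|}. -/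
open Complex Metric Finset Filter

noncomputable section

/-- Pointwise Lipschitz estimate for the right-hand side. -/
theorem alderiv_sub_le (p q : ℝ → ℤ → ℂ) (s : ℝ) (hp : ∀ m, ‖p s m‖ ≤ 1)
    (hq : ∀ m, ‖q s m‖ ≤ 1) (n : ℤ) :
    ‖ALDeriv p s n - ALDeriv q s n‖ ≤ ‖p s (n - 1) - q s (n - 1)‖
      + ‖p s (n + 1) - q s (n + 1)‖ + 4 * ‖p s n - q s n‖ := by
  have e : ALDeriv p s n - ALDeriv q s n =
      Complex.I * ((((1 - ‖p s n‖ ^ 2 : ℝ) : ℂ) *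
        ((p s (n - 1) - q s (n - 1)) + (p s (n + 1) - q s (n + 1))))
      + (((‖q s n‖ ^ 2 - ‖p s n‖ ^ 2 : ℝ) : ℂ) * (q s (n - 1) + q s (n + 1)))) := by
    unfold ALDeriv
    push_cast
    ring
  have a0 := norm_nonneg (p s n)
  have b0 := norm_nonneg (q s n)
  have a1 := hp n
  have b1 := hq n
  have h1 : |1 - ‖p s n‖ ^ 2| ≤ 1 := by
    rw [abs_le]; constructor <;> nlinarith
  have h2 : |‖q s n‖ ^ 2 - ‖p s n‖ ^ 2| ≤ 2 * ‖p s n - q s n‖ := by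
    have h3 : |‖q s n‖ - ‖p s n‖| ≤ ‖p s n - q s n‖ := by
      rw [norm_sub_rev]; exact abs_norm_sub_norm_le _ _
    have h4 : ‖q s n‖ ^ 2 - ‖p s n‖ ^ 2 = (‖q s n‖ + ‖p s n‖) * (‖q s n‖ - ‖p s n‖) := by ring
    rw [h4, abs_mul, abs_of_nonneg (by positivity : 0 ≤ ‖q s n‖ + ‖p s n‖)]
    exact mul_le_mul (by linarith) h3 (abs_nonneg _) (by norm_num)
  have h5 : ‖q s (n - 1) + q s (n + 1)‖ ≤ 2 :=
    (norm_add_le _ _).trans (by linarith [hq (n - 1), hq (n + 1)])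
  have h6 := norm_add_le (p s (n - 1) - q s (n - 1)) (p s (n + 1) - q s (n + 1))
  rw [e, norm_mul, Complex.norm_I, one_mul]
  refine (norm_add_le _ _).trans ?_
  rw [norm_mul, norm_mul, Complex.norm_real, Complex.norm_real, Real.norm_eq_abs,
    Real.norm_eq_abs]
  have h7 := mul_le_mul h1 h6 (norm_nonneg _) (by norm_num)
  have h8 := mul_le_mul h2 h5 (norm_nonneg _) (by positivity)
  linarith

theorem stmt14 (q0 : ℤ → ℂ) (hq0 : ∀ n : ℤ, ‖q0 n‖ < 1)
    (N : ℕ) (q0N : ℤ → ℂ)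
    (hq0N : ∀ n : ℤ, q0N n = if |n| ≤ (N : ℤ) then q0 n else 0)
    (q qN : ℝ → ℤ → ℂ)
    (hqi : ∀ n : ℤ, q 0 n = q0 n) (hqNi : ∀ n : ℤ, qN 0 n = q0N n)
    (hq : ∀ (n : ℤ), ∀ s ∈ Set.Ici (0 : ℝ),
      HasDerivWithinAt (fun u => q u n) (ALDeriv q s n) (Set.Ici (0 : ℝ)) s)
    (hqN : ∀ (n : ℤ), ∀ s ∈ Set.Ici (0 : ℝ),
      HasDerivWithinAt (fun u => qN u n) (ALDeriv qN s n) (Set.Ici (0 : ℝ)) s)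
    (hqb : ∀ s ∈ Set.Ici (0 : ℝ), ∀ m : ℤ, ‖q s m‖ ≤ 1)
    (hqNb : ∀ s ∈ Set.Ici (0 : ℝ), ∀ m : ℤ, ‖qN s m‖ ≤ 1) :
    ∀ (j : ℤ), |j| ≤ (N : ℤ) → ∀ (t : ℝ), 0 < t → ∀ (r : ℝ), 0 < r → r < 1 →
      ‖q t j - qN t j‖ ≤
        Real.sqrt 2 * r * Real.exp (10 * t / r ^ 2) / Real.sqrt (1 - r ^ 2) *
          r ^ ((N : ℤ) - |j|) := by
  intro j hj t ht r hr hr1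
  set W : ℤ → ℝ := fun n => r ^ ((N : ℤ) + 1 - |n|) with hW
  have hWpos : ∀ n, 0 < W n := fun n => zpow_pos hr _
  have hWn : ∀ n m : ℤ, |m| ≤ |n| + 1 → W m ≤ W n / r := by
    intro n m h
    have : W n / r = r ^ ((N : ℤ) + 1 - |n| - 1) := by
      rw [zpow_sub_one₀ hr.ne']; rfl
    rw [this]
    exact zpow_le_zpow_right_of_le_one₀ hr hr1.le (by omega)
  have key : ∀ k : ℕ, ∀ n : ℤ, ∀ s : ℝ, 0 ≤ s →
      ‖q s n - qN s n‖ ≤ W n * Real.exp (6 / r * s) + 2 * ((6 * s) ^ k / (k.factorial : ℝ)) := by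
    intro k
    induction k with
    | zero =>
      intro n s hs
      have h1 := norm_sub_le (q s n) (qN s n)
      have h2 := hqb s hs n
      have h3 := hqNb s hs n
      have h4 := mul_pos (hWpos n) (Real.exp_pos (6 / r * s))
      simp only [pow_zero, Nat.factorial_zero, Nat.cast_one]
      linarith
    | succ k ih =>
      intro n s hs
      have hd : ∀ x ∈ Set.Ici (0 : ℝ), HasDerivWithinAt (fun u => q u n - qN u n)
          (ALDeriv q x n - ALDeriv qN x n) (Set.Ici 0) x :=
        fun x hx => (hq n x hx).sub (hqN n x hx)
      refine image_norm_le_of_norm_deriv_right_le_deriv_boundary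
        (a := 0) (b := s) (f := fun u => q u n - qN u n)
        (f' := fun x => ALDeriv q x n - ALDeriv qN x n)
        (B := fun x => W n * Real.exp (6 / r * x)
          + 2 * ((6 * x) ^ (k + 1) / ((k + 1).factorial : ℝ)))
        (B' := fun x => W n * (Real.exp (6 / r * x) * (6 / r))
          + 2 * (6 * ((6 * x) ^ k / (k.factorial : ℝ))))
        ?_ ?_ ?_ ?_ ?_ (Set.right_mem_Icc.2 hs)
      · intro x hx
        exact (hd x hx.1).continuousWithinAt.mono Set.Icc_subset_Ici_self
      · intro x hx
        exact (hd x hx.1).mono (Set.Ici_subset_Ici.2 hx.1)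
      · simp only [hqi, hqNi, hq0N, mul_zero, Real.exp_zero, mul_one, ne_eq,
          Nat.succ_ne_zero, not_false_eq_true, zero_pow, zero_div, add_zero]
        split_ifs with h
        · simpa using (hWpos n).le
        · have : r ^ (0 : ℤ) ≤ W n := zpow_le_zpow_right_of_le_one₀ hr hr1.le (by omega)
          rw [zpow_zero] at this
          rw [sub_zero]
          exact (hq0 n).le.trans this
      · intro x
        have h1 : HasDerivAt (fun x : ℝ => 6 / r * x) (6 / r) x := by
          simpa using (hasDerivAt_id x).const_mul (6 / r)
        have h2 : HasDerivAt (fun x : ℝ => 6 * x) 6 x := by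
          simpa using (hasDerivAt_id x).const_mul (6 : ℝ)
        have h3 := (h1.exp.const_mul (W n)).add
          (((h2.pow (k + 1)).div_const ((k + 1).factorial : ℝ)).const_mul 2)
        refine HasDerivAt.congr_deriv h3 ?_
        have hk : (k.factorial : ℝ) ≠ 0 := by positivity
        have hk1 : (k : ℝ) + 1 ≠ 0 := by positivity
        rw [Nat.factorial_succ]
        push_cast
        field_simp
      · intro x hx
        have hx0 : 0 ≤ x := hx.1
        refine (alderiv_sub_le q qN x (hqb x hx0) (hqNb x hx0) n).trans ?_
        have i1 := ih (n - 1) x hx0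
        have i2 := ih (n + 1) x hx0
        have i3 := ih n x hx0
        have w1 := hWn n (n - 1) (by simpa using abs_sub n 1)
        have w2 := hWn n (n + 1) (by simpa using abs_add_le n 1)
        have w3 := hWn n n (by omega)
        have E := Real.exp_pos (6 / r * x)
        have v1 := mul_le_mul_of_nonneg_right w1 E.le
        have v2 := mul_le_mul_of_nonneg_right w2 E.le
        have v3 := mul_le_mul_of_nonneg_right w3 E.le
        have : W n * (Real.exp (6 / r * x) * (6 / r)) = 6 * (W n / r * Real.exp (6 / r * x)) := by
          ring
        rw [this]
        linarith
  have lim : ‖q t j - qN t j‖ ≤ W j * Real.exp (6 / r * t) := by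
    have h := (((FloorSemiring.tendsto_pow_div_factorial_atTop (6 * t)).const_mul 2).const_add
      (W j * Real.exp (6 / r * t)))
    rw [mul_zero, add_zero] at h
    exact ge_of_tendsto' h (fun k => key k j t ht.le)
  refine lim.trans ?_
  have hWj : W j = r * r ^ ((N : ℤ) - |j|) := by
    rw [← zpow_one_add₀ hr.ne']
    simp only [hW]
    congr 1
    ring
  have hZ : 0 < r ^ ((N : ℤ) - |j|) := zpow_pos hr _
  have hE : Real.exp (6 / r * t) ≤ Real.exp (10 * t / r ^ 2) := by
    apply Real.exp_le_exp.2
    rw [div_mul_eq_mul_div, div_le_div_iff₀ hr (by positivity)]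
    have : 0 < t * r := by positivity
    nlinarith
  have hs : 0 < Real.sqrt (1 - r ^ 2) := Real.sqrt_pos.2 (by nlinarith)
  have hs1 : Real.sqrt (1 - r ^ 2) ≤ Real.sqrt 2 := Real.sqrt_le_sqrt (by nlinarith)
  have hq1 : 1 ≤ Real.sqrt 2 / Real.sqrt (1 - r ^ 2) := (one_le_div hs).2 hs1
  rw [hWj]
  calc r * r ^ ((N : ℤ) - |j|) * Real.exp (6 / r * t)
      ≤ r * r ^ ((N : ℤ) - |j|) * Real.exp (10 * t / r ^ 2) := by gcongr
    _ ≤ (Real.sqrt 2 / Real.sqrt (1 - r ^ 2)) *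
        (r * r ^ ((N : ℤ) - |j|) * Real.exp (10 * t / r ^ 2)) :=
        le_mul_of_one_le_left (by positivity) hq1
    _ = _ := by ring
end
end

section
/- Let q₀ : ℤ → ℂ satisfy |q₀(n)| < 1 for all n and Σ_{n∈ℤ} |q₀(n)|² < ∞. Fix N ∈ ℕ and let q₀,N be the truncated datum: q₀,N(n) = q₀(n) for |n| ≤ N and q₀,N(n) = 0 for |n| > N. Let q and q_N solve the Ablowitz–Ladik equation on [0,∞) with initial data q₀ and q₀,N respectively, with |q(s,m)| ≤ 1 and |q_N(s,m)| ≤ 1 for all s ≥ 0, m ∈ ℤ. Then for every j ∈ ℤ with N ≥ |j|, every t > 0 and every r ∈ (0,1): |q(t,j) − q_N(t,j)| ≤ r · e^{10t/r²} · ( Σ_{|m| > N} |q₀(m)|² )^{1/2} · r^{N−|j|}. -/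
open Complex Metric Finset Filter

noncomputable section

theorem AL_diff (a b a1 a2 b1 b2 : ℂ) (ha : ‖a‖ ≤ 1) (hb : ‖b‖ ≤ 1) (hb1 : ‖b1‖ ≤ 1)
    (hb2 : ‖b2‖ ≤ 1) :
    ‖Complex.I * ((1 - ‖a‖ ^ 2 : ℝ) : ℂ) * (a1 + a2)
      - Complex.I * ((1 - ‖b‖ ^ 2 : ℝ) : ℂ) * (b1 + b2)‖
      ≤ ‖a1 - b1‖ + ‖a2 - b2‖ + 4 * ‖a - b‖ := by
  have e : Complex.I * ((1 - ‖a‖ ^ 2 : ℝ) : ℂ) * (a1 + a2)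
      - Complex.I * ((1 - ‖b‖ ^ 2 : ℝ) : ℂ) * (b1 + b2)
      = Complex.I * (((1 - ‖a‖ ^ 2 : ℝ) : ℂ) * ((a1 - b1) + (a2 - b2))
        + ((‖b‖ ^ 2 - ‖a‖ ^ 2 : ℝ) : ℂ) * (b1 + b2)) := by
    push_cast; ring
  rw [e, norm_mul, Complex.norm_I, one_mul]
  refine (norm_add_le _ _).trans ?_
  rw [norm_mul, norm_mul, Complex.norm_real, Complex.norm_real, Real.norm_eq_abs,
    Real.norm_eq_abs]
  have na := norm_nonneg a
  have nb := norm_nonneg b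
  have h1 : |1 - ‖a‖ ^ 2| ≤ 1 := by rw [abs_le]; constructor <;> nlinarith
  have h2 : |‖b‖ ^ 2 - ‖a‖ ^ 2| ≤ 2 * ‖a - b‖ := by
    have h3 : ‖b‖ ^ 2 - ‖a‖ ^ 2 = (‖b‖ + ‖a‖) * (‖b‖ - ‖a‖) := by ring
    rw [h3, abs_mul, norm_sub_rev]
    have h4 := abs_norm_sub_norm_le b a
    have h5 : |‖b‖ + ‖a‖| ≤ 2 := by rw [abs_le]; constructor <;> linarith
    exact mul_le_mul h5 h4 (abs_nonneg _) (by norm_num)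
  have h6 : ‖(a1 - b1) + (a2 - b2)‖ ≤ ‖a1 - b1‖ + ‖a2 - b2‖ := norm_add_le _ _
  have h7 : ‖b1 + b2‖ ≤ 2 := (norm_add_le _ _).trans (by linarith)
  have h8 := mul_le_mul h1 h6 (norm_nonneg _) (by norm_num)
  have h9 := mul_le_mul h2 h7 (norm_nonneg _) (by positivity)
  linarith

theorem E_deriv (A C : ℝ) (k : ℕ) (u : ℝ) :
    HasDerivAt (fun u : ℝ => A * Real.exp (C * u) + 2 * ((C * u) ^ (k + 1) / ((k + 1).factorial : ℝ)))
      (C * (A * Real.exp (C * u) + 2 * ((C * u) ^ k / (k.factorial : ℝ)))) u := by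
  have h0 : HasDerivAt (fun u : ℝ => C * u) C u := by
    simpa using (hasDerivAt_id u).const_mul C
  have h1 := (h0.exp.const_mul A).add
    (((h0.pow (k + 1)).div_const ((k + 1).factorial : ℝ)).const_mul 2)
  refine h1.congr_deriv ?_
  have : (k.factorial : ℝ) ≠ 0 := by positivity
  have : ((k : ℝ) + 1) ≠ 0 := by positivity
  rw [Nat.factorial_succ]
  push_cast
  try simp only [Nat.add_sub_cancel]
  field_simp

theorem stmt15 (q0 : ℤ → ℂ) (hq0 : ∀ n : ℤ, ‖q0 n‖ < 1)
    (hq0sum : Summable fun n : ℤ => ‖q0 n‖ ^ 2)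
    (N : ℕ) (q0N : ℤ → ℂ)
    (hq0N : ∀ n : ℤ, q0N n = if |n| ≤ (N : ℤ) then q0 n else 0)
    (q qN : ℝ → ℤ → ℂ)
    (hqi : ∀ n : ℤ, q 0 n = q0 n) (hqNi : ∀ n : ℤ, qN 0 n = q0N n)
    (hq : ∀ (n : ℤ), ∀ s ∈ Set.Ici (0 : ℝ),
      HasDerivWithinAt (fun u => q u n) (ALDeriv q s n) (Set.Ici (0 : ℝ)) s)
    (hqN : ∀ (n : ℤ), ∀ s ∈ Set.Ici (0 : ℝ),
      HasDerivWithinAt (fun u => qN u n) (ALDeriv qN s n) (Set.Ici (0 : ℝ)) s)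
    (hqb : ∀ s ∈ Set.Ici (0 : ℝ), ∀ m : ℤ, ‖q s m‖ ≤ 1)
    (hqNb : ∀ s ∈ Set.Ici (0 : ℝ), ∀ m : ℤ, ‖qN s m‖ ≤ 1) :
    ∀ (j : ℤ), |j| ≤ (N : ℤ) → ∀ (t : ℝ), 0 < t → ∀ (r : ℝ), 0 < r → r < 1 →
      ‖q t j - qN t j‖ ≤
        r * Real.exp (10 * t / r ^ 2) *
          Real.sqrt (∑' m : ℤ, if (N : ℤ) < |m| then ‖q0 m‖ ^ 2 else 0) *
          r ^ ((N : ℤ) - |j|) := by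
  intro j hj t ht r hr0 hr1
  have habs := Int.abs_eq_natAbs j
  set S := ∑' m : ℤ, if (N : ℤ) < |m| then ‖q0 m‖ ^ 2 else 0 with hS
  have hsum : Summable fun m : ℤ => if (N : ℤ) < |m| then ‖q0 m‖ ^ 2 else 0 := by
    refine Summable.of_nonneg_of_le (fun m => ?_) (fun m => ?_) hq0sum
    · split_ifs <;> positivity
    · split_ifs
      · exact le_rfl
      · positivity
  have hle : ∀ m : ℤ, (N : ℤ) < |m| → ‖q0 m‖ ≤ Real.sqrt S := by
    intro m hm
    apply Real.le_sqrt_of_sq_le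
    have := hsum.le_tsum m (fun i _ => by split_ifs <;> positivity)
    simpa [hm] using this
  set A := r ^ (N + 1 - j.natAbs) * Real.sqrt S with hA
  have hA0 : 0 ≤ A := by positivity
  set C := 10 / r ^ 2 with hC
  have hC0 : 0 ≤ C := by positivity
  have hC1 : 2 / r + 4 ≤ C := by
    rw [hC, le_div_iff₀ (by positivity)]
    have : (2 / r + 4) * r ^ 2 = 2 * r + 4 * r ^ 2 := by field_simp
    rw [this]; nlinarith
  have main : ∀ k : ℕ, ∀ n : ℤ, ∀ u : ℝ, 0 ≤ u → r ^ (n - j).natAbs * ‖q u n - qN u n‖ ≤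
      A * Real.exp (C * u) + 2 * ((C * u) ^ k / (k.factorial : ℝ)) := by
    intro k
    induction k with
    | zero =>
      intro n u hu
      have h1 : ‖q u n - qN u n‖ ≤ 2 := (norm_sub_le _ _).trans
        (by linarith [hqb u hu n, hqNb u hu n])
      have h2 : r ^ (n - j).natAbs ≤ 1 := pow_le_one₀ hr0.le hr1.le
      have h3 := mul_le_mul h2 h1 (norm_nonneg _) (by norm_num)
      have h4 : 0 ≤ A * Real.exp (C * u) := by positivity
      simp only [pow_zero, Nat.factorial_zero, Nat.cast_one, div_one]
      linarith
    | succ k ih =>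
      intro n u hu
      have key := image_norm_le_of_norm_deriv_right_le_deriv_boundary
        (f := fun v => ((r ^ (n - j).natAbs : ℝ) : ℂ) * (q v n - qN v n))
        (f' := fun v => ((r ^ (n - j).natAbs : ℝ) : ℂ) * (ALDeriv q v n - ALDeriv qN v n))
        (a := 0) (b := u)
        (B := fun u : ℝ => A * Real.exp (C * u) + 2 * ((C * u) ^ (k + 1) / ((k + 1).factorial : ℝ)))
        (B' := fun u : ℝ => C * (A * Real.exp (C * u) + 2 * ((C * u) ^ k / (k.factorial : ℝ))))
        ?_ ?_ ?_ (fun x => E_deriv A C k x) ?_ (Set.right_mem_Icc.2 hu)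
      · rw [norm_mul, Complex.norm_real, Real.norm_of_nonneg (by positivity)] at key
        exact key
      · intro x hx
        exact ((((hq n x hx.1).sub (hqN n x hx.1)).const_mul _).continuousWithinAt).mono
          (fun y hy => hy.1)
      · intro x hx
        exact (((hq n x hx.1).sub (hqN n x hx.1)).const_mul _).mono
          (fun y hy => le_trans hx.1 hy)
      · rw [norm_mul, Complex.norm_real, Real.norm_of_nonneg (by positivity)]
        simp only [mul_zero, Real.exp_zero, mul_one]
        rw [zero_pow (by omega), zero_div, mul_zero, add_zero, hqi, hqNi, hq0N]
        have habsn := Int.abs_eq_natAbs n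
        split_ifs with hn
        · simpa using hA0
        · rw [sub_zero]
          refine mul_le_mul ?_ (hle n (by omega)) (norm_nonneg _) (by positivity)
          exact pow_le_pow_of_le_one hr0.le hr1.le (by omega)
      · intro x hx
        have hx0 : 0 ≤ x := hx.1
        simp only [norm_mul]
        rw [Complex.norm_real, Real.norm_of_nonneg (by positivity)]
        have hd := AL_diff (q x n) (qN x n) (q x (n - 1)) (q x (n + 1)) (qN x (n - 1))
          (qN x (n + 1)) (hqb x hx0 n) (hqNb x hx0 n) (hqNb x hx0 _) (hqNb x hx0 _)
        set E := A * Real.exp (C * x) + 2 * ((C * x) ^ k / (k.factorial : ℝ)) with hE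
        have hE0 : 0 ≤ E := by positivity
        have nb : ∀ m : ℤ, (m - j).natAbs ≤ (n - j).natAbs + 1 →
            r ^ (n - j).natAbs * ‖q x m - qN x m‖ ≤ E / r := by
          intro m hm
          rw [le_div_iff₀ hr0]
          have h1 : r ^ ((n - j).natAbs + 1) ≤ r ^ (m - j).natAbs :=
            pow_le_pow_of_le_one hr0.le hr1.le hm
          have h2 := mul_le_mul_of_nonneg_right h1 (norm_nonneg (q x m - qN x m))
          have h3 := ih m x hx0
          rw [pow_succ] at h2
          linarith
        have h1 := nb (n - 1) (by omega)
        have h2 := nb (n + 1) (by omega)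
        have h3 := ih n x hx0
        have h4 : (2 / r + 4) * E ≤ C * E := mul_le_mul_of_nonneg_right hC1 hE0
        have h5 : (2 / r + 4) * E = E / r + E / r + 4 * E := by ring
        have h6 := mul_le_mul_of_nonneg_left hd (by positivity : 0 ≤ r ^ (n - j).natAbs)
        refine le_trans h6 ?_
        linarith
  have hlim : Tendsto (fun k : ℕ => A * Real.exp (C * t) + 2 * ((C * t) ^ k / (k.factorial : ℝ)))
      atTop (nhds (A * Real.exp (C * t) + 2 * 0)) :=
    ((FloorSemiring.tendsto_pow_div_factorial_atTop (C * t)).const_mul 2).const_add _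
  have hfin := ge_of_tendsto' hlim (fun k => main k j t ht.le)
  simp only [sub_self, Int.natAbs_zero, pow_zero, one_mul, mul_zero, add_zero] at hfin
  refine hfin.trans (le_of_eq ?_)
  have e1 : (N : ℤ) - |j| = ((N - j.natAbs : ℕ) : ℤ) := by omega
  have e2 : N + 1 - j.natAbs = (N - j.natAbs) + 1 := by omega
  have e3 : C * t = 10 * t / r ^ 2 := by rw [hC]; ring
  rw [e1, zpow_natCast, hA, e2, e3, pow_succ]
  ring
end
end

section
/- Let q : ℤ → ℂ be finitely supported with |q(k)| < 1 for all k ∈ ℤ. Then for every z on the unit circle 𝕋: (i) (T_q(z))₂₁ = conj(b_q(z)) and (T_q(z))₂₂ = conj(a_q(z)); (ii) |a_q(z)|² − |b_q(z)|² = 1 (in particular a_q(z) ≠ 0); and (iii) ∫_𝕋 log( 1 − |b_q(ξ)/a_q(ξ)|² ) dm(ξ) = Σ_{k∈ℤ} log(1 − |q(k)|²). -/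
open Complex Metric Finset Filter

noncomputable section

/-- The single transfer-matrix factor
`(1 - |q k|²)^{-1/2} · [[1, conj(q k)·z^{-k}], [q k·z^k, 1]]`. -/
def transferFactor (q : ℤ → ℂ) (z : ℂ) (k : ℤ) : Matrix (Fin 2) (Fin 2) ℂ :=
  ((Real.sqrt (1 - ‖q k‖ ^ 2))⁻¹ : ℝ) •
    !![1, (starRingEnd ℂ) (q k) * z ^ (-k); q k * z ^ k, 1]

/-- The ordered product `T_q(z)` of the transfer-matrix factors over `k = A, A+1, …, B`,
taken left to right. -/
def Tq (q : ℤ → ℂ) (A B : ℤ) (z : ℂ) : Matrix (Fin 2) (Fin 2) ℂ :=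
  (((Finset.Icc A B).sort (· ≤ ·)).map (transferFactor q z)).prod

/-- The product over an arbitrary list. -/
def TL (q : ℤ → ℂ) (l : List ℤ) (z : ℂ) : Matrix (Fin 2) (Fin 2) ℂ :=
  (l.map (transferFactor q z)).prod

/-- The normalizing constant. -/
def nrm (q : ℤ → ℂ) (k : ℤ) : ℝ := (Real.sqrt (1 - ‖q k‖ ^ 2))⁻¹

theorem one_sub_pos (q : ℤ → ℂ) (hq : ∀ k : ℤ, ‖q k‖ < 1) (k : ℤ) : 0 < 1 - ‖q k‖ ^ 2 := by
  have := hq k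
  have := norm_nonneg (q k)
  nlinarith

theorem nrm_pos (q : ℤ → ℂ) (hq : ∀ k : ℤ, ‖q k‖ < 1) (k : ℤ) : 0 < nrm q k :=
  inv_pos.2 (Real.sqrt_pos.2 (one_sub_pos q hq k))

theorem nrm_sq (q : ℤ → ℂ) (hq : ∀ k : ℤ, ‖q k‖ < 1) (k : ℤ) :
    nrm q k ^ 2 * (1 - ‖q k‖ ^ 2) = 1 := by
  have h := one_sub_pos q hq k
  rw [nrm, inv_pow, Real.sq_sqrt h.le, inv_mul_cancel₀ h.ne']

theorem TL_cons (q : ℤ → ℂ) (k : ℤ) (l : List ℤ) (z : ℂ) :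
    TL q (k :: l) z 0 0 = nrm q k *
      (TL q l z 0 0 + (starRingEnd ℂ) (q k) * z ^ (-k) * TL q l z 1 0) ∧
    TL q (k :: l) z 0 1 = nrm q k *
      (TL q l z 0 1 + (starRingEnd ℂ) (q k) * z ^ (-k) * TL q l z 1 1) ∧
    TL q (k :: l) z 1 0 = nrm q k * (q k * z ^ k * TL q l z 0 0 + TL q l z 1 0) ∧
    TL q (k :: l) z 1 1 = nrm q k * (q k * z ^ k * TL q l z 0 1 + TL q l z 1 1) := by
  simp only [TL, List.map_cons, List.prod_cons, transferFactor, Matrix.mul_apply, Fin.sum_univ_two,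
    nrm, Matrix.smul_apply, Complex.real_smul]
  simp only [Matrix.of_apply, Matrix.cons_val_zero, Matrix.cons_val_one, Matrix.cons_val',
    Matrix.cons_val_fin_one]
  refine ⟨?_, ?_, ?_, ?_⟩ <;> ring

theorem TL_unit (q : ℤ → ℂ) (hq : ∀ k : ℤ, ‖q k‖ < 1) (z : ℂ) (hz : ‖z‖ = 1) (l : List ℤ) :
    TL q l z 1 0 = (starRingEnd ℂ) (TL q l z 0 1) ∧
    TL q l z 1 1 = (starRingEnd ℂ) (TL q l z 0 0) ∧
    TL q l z 0 0 * (starRingEnd ℂ) (TL q l z 0 0)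
      - TL q l z 0 1 * (starRingEnd ℂ) (TL q l z 0 1) = 1 := by
  have hz0 : z ≠ 0 := by rintro rfl; simp at hz
  have hc : (starRingEnd ℂ) z = z⁻¹ := (Complex.inv_eq_conj hz).symm
  induction l with
  | nil => simp [TL]
  | cons k l ih =>
    obtain ⟨h1, h2, h3⟩ := ih
    obtain ⟨e1, e2, e3, e4⟩ := TL_cons q k l z
    have hs : (nrm q k : ℂ) ^ 2 * (1 - q k * (starRingEnd ℂ) (q k)) = 1 := by
      rw [Complex.mul_conj']
      exact_mod_cast nrm_sq q hq k
    have hzz : z ^ (-k) * z ^ k = 1 := by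
      rw [← zpow_add₀ hz0]; simp
    have c1 : (starRingEnd ℂ) (z ^ (-k)) = z ^ k := by
      rw [map_zpow₀, hc]; simp
    rw [e1, e2, e3, e4, h1, h2]
    simp only [map_mul, map_add, Complex.conj_conj, Complex.conj_ofReal, c1]
    refine ⟨by ring, by ring, ?_⟩
    generalize TL q l z 0 0 = a at *
    generalize TL q l z 0 1 = b at *
    generalize z ^ (-k) = w at *
    generalize z ^ k = w' at *
    generalize (starRingEnd ℂ) a = a' at *
    generalize (starRingEnd ℂ) b = b' at *
    generalize (starRingEnd ℂ) (q k) = p' at *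
    generalize q k = p at *
    generalize (nrm q k : ℂ) = s at *
    linear_combination (s ^ 2 * (1 - p * p')) * h3 + hs
      + s ^ 2 * p * p' * (b * b' - a * a') * hzz

theorem TL_disc (q : ℤ → ℂ) (hq : ∀ k : ℤ, ‖q k‖ < 1) (l : List ℤ) (hl : l.Pairwise (· < ·)) :
    ∃ a : ℂ → ℂ, Differentiable ℂ a ∧ (∀ z, z ≠ 0 → TL q l z 0 0 = a z) ∧
      (∀ z, ‖z‖ ≤ 1 → a z ≠ 0) ∧
      Real.log ‖a 0‖ = -(1 / 2) * (l.map (fun k => Real.log (1 - ‖q k‖ ^ 2))).sum ∧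
      ∀ m : ℤ, (∀ x ∈ l, m ≤ x) → ∃ g : ℂ → ℂ, Differentiable ℂ g ∧
        (∀ z, z ≠ 0 → TL q l z 1 0 = z ^ m * g z) ∧ ∀ z, ‖z‖ ≤ 1 → ‖g z‖ ≤ ‖a z‖ := by
  induction l with
  | nil =>
    refine ⟨fun _ => 1, by fun_prop, by simp [TL], by simp, by simp, fun m _ => ?_⟩
    exact ⟨fun _ => 0, by fun_prop, by simp [TL], by simp⟩
  | cons k l ih =>
    rw [List.pairwise_cons] at hl
    obtain ⟨a, ha, haT, ha0, halog, hg⟩ := ih hl.2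
    obtain ⟨g, hgd, hgT, hgle⟩ := hg (k + 1) (fun x hx => hl.1 x hx)
    have hsp := nrm_pos q hq k
    have hne : ∀ z, ‖z‖ ≤ 1 → a z + (starRingEnd ℂ) (q k) * (z * g z) ≠ 0 := by
      intro z hz h
      have h1 : ‖a z‖ = ‖q k‖ * (‖z‖ * ‖g z‖) := by
        rw [eq_neg_of_add_eq_zero_left h]; simp
      have h2 : ‖z‖ * ‖g z‖ ≤ ‖a z‖ := by
        have := hgle z hz
        nlinarith [norm_nonneg z, norm_nonneg (g z)]
      have h3 : 0 < ‖a z‖ := norm_pos_iff.2 (ha0 z hz)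
      nlinarith [hq k, norm_nonneg (q k)]
    refine ⟨fun z => nrm q k * (a z + (starRingEnd ℂ) (q k) * (z * g z)), by fun_prop,
      ?_, ?_, ?_, ?_⟩
    · intro z hz
      rw [(TL_cons q k l z).1, haT z hz, hgT z hz, zpow_add₀ hz, zpow_neg, zpow_one]
      have := zpow_ne_zero k hz
      field_simp
    · intro z hz
      exact mul_ne_zero (by exact_mod_cast hsp.ne') (hne z hz)
    · have h0 : ‖a 0‖ ≠ 0 := norm_ne_zero_iff.2 (ha0 0 (by simp))
      simp only [zero_mul, mul_zero, add_zero, norm_mul, List.map_cons, List.sum_cons]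
      rw [Complex.norm_real, Real.norm_of_nonneg hsp.le, Real.log_mul hsp.ne' h0, halog, nrm,
        Real.log_inv, Real.log_sqrt (one_sub_pos q hq k).le]
      ring
    · intro m hm
      obtain ⟨n, hn⟩ := Int.le.dest (hm k (by simp))
      refine ⟨fun z => nrm q k * (z ^ n * (q k * a z + z * g z)), by fun_prop, ?_, ?_⟩
      · intro z hz
        have hk : z ^ k = z ^ m * z ^ n := by rw [← hn, zpow_add₀ hz, zpow_natCast]
        rw [(TL_cons q k l z).2.2.1, haT z hz, hgT z hz, zpow_add₀ hz, zpow_one, hk]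
        ring
      · intro z hz
        beta_reduce
        rw [norm_mul, norm_mul (nrm q k : ℂ)]
        refine mul_le_mul_of_nonneg_left ?_ (norm_nonneg _)
        rw [norm_mul, norm_pow]
        refine (mul_le_of_le_one_left (norm_nonneg _) (pow_le_one₀ (norm_nonneg _) hz)).trans ?_
        have h2 : ‖z * g z‖ ≤ ‖a z‖ := by
          rw [norm_mul]
          have := hgle z hz
          nlinarith [norm_nonneg z, norm_nonneg (g z)]
        generalize z * g z = u at *
        generalize a z = v at *
        have key : ‖v + (starRingEnd ℂ) (q k) * u‖ ^ 2 - ‖q k * v + u‖ ^ 2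
            = (1 - ‖q k‖ ^ 2) * (‖v‖ ^ 2 - ‖u‖ ^ 2) := by
          simp only [← Complex.normSq_eq_norm_sq, Complex.normSq_apply, Complex.add_re,
            Complex.add_im, Complex.mul_re, Complex.mul_im, Complex.conj_re, Complex.conj_im]
          ring
        have h4 : 0 ≤ (1 - ‖q k‖ ^ 2) * (‖v‖ ^ 2 - ‖u‖ ^ 2) := by
          refine mul_nonneg (one_sub_pos q hq k).le ?_
          nlinarith [norm_nonneg u, norm_nonneg v]
        exact (sq_le_sq₀ (norm_nonneg _) (norm_nonneg _)).1 (by linarith)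

theorem stmt17 (q : ℤ → ℂ) (hq : ∀ k : ℤ, ‖q k‖ < 1) (A B : ℤ)
    (hsupp : ∀ k : ℤ, q k ≠ 0 → A ≤ k ∧ k ≤ B) :
    (∀ z : ℂ, ‖z‖ = 1 →
      (Tq q A B z) 1 0 = (starRingEnd ℂ) ((Tq q A B z) 0 1) ∧
      (Tq q A B z) 1 1 = (starRingEnd ℂ) ((Tq q A B z) 0 0) ∧
      ‖(Tq q A B z) 0 0‖ ^ 2 - ‖(Tq q A B z) 0 1‖ ^ 2 = 1 ∧
      (Tq q A B z) 0 0 ≠ 0) ∧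
    (2 * Real.pi)⁻¹ *
        (∫ θ in (0:ℝ)..(2 * Real.pi),
          Real.log (1 - ‖(Tq q A B (Complex.exp (θ * Complex.I))) 0 1 /
            (Tq q A B (Complex.exp (θ * Complex.I))) 0 0‖ ^ 2)) =
      ∑' k : ℤ, Real.log (1 - ‖q k‖ ^ 2) := by
  have part1 : ∀ z : ℂ, ‖z‖ = 1 →
      (Tq q A B z) 1 0 = (starRingEnd ℂ) ((Tq q A B z) 0 1) ∧
      (Tq q A B z) 1 1 = (starRingEnd ℂ) ((Tq q A B z) 0 0) ∧
      ‖(Tq q A B z) 0 0‖ ^ 2 - ‖(Tq q A B z) 0 1‖ ^ 2 = 1 ∧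
      (Tq q A B z) 0 0 ≠ 0 := by
    intro z hz
    obtain ⟨h1, h2, h3⟩ := TL_unit q hq z hz ((Finset.Icc A B).sort (· ≤ ·))
    have h4 : ‖(Tq q A B z) 0 0‖ ^ 2 - ‖(Tq q A B z) 0 1‖ ^ 2 = 1 := by
      rw [Complex.mul_conj', Complex.mul_conj'] at h3
      exact_mod_cast h3
    refine ⟨h1, h2, h4, fun h => ?_⟩
    rw [h] at h4
    have := sq_nonneg ‖(Tq q A B z) 0 1‖
    simp at h4
    linarith
  refine ⟨part1, ?_⟩
  obtain ⟨a, ha, haT, ha0, halog, -⟩ :=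
    TL_disc q hq ((Finset.Icc A B).sort (· ≤ ·)) (Finset.sortedLT_sort _).pairwise
  have hmean : Real.circleAverage (fun z => Real.log ‖a z‖) 0 1 = Real.log ‖a 0‖ := by
    refine AnalyticOnNhd.circleAverage_log_norm_of_ne_zero (fun z _ => ha.analyticAt z) ?_
    intro u hu
    exact ha0 u (by simpa using hu)
  have hint : ∀ θ : ℝ, Real.log (1 - ‖(Tq q A B (Complex.exp (θ * Complex.I))) 0 1 /
            (Tq q A B (Complex.exp (θ * Complex.I))) 0 0‖ ^ 2)
      = -2 * Real.log ‖a (circleMap 0 1 θ)‖ := by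
    intro θ
    obtain ⟨-, -, h3, h4⟩ := part1 _ (Complex.norm_exp_ofReal_mul_I θ)
    have h5 : circleMap 0 1 θ = Complex.exp (θ * Complex.I) := by simp [circleMap]
    rw [h5, ← haT _ (Complex.exp_ne_zero _)]
    change _ = -2 * Real.log ‖Tq q A B (Complex.exp (θ * Complex.I)) 0 0‖
    have h6 : ‖Tq q A B (Complex.exp (θ * Complex.I)) 0 0‖ ≠ 0 := norm_ne_zero_iff.2 h4
    have h7 : 1 - ‖(Tq q A B (Complex.exp (θ * Complex.I))) 0 1 /
            (Tq q A B (Complex.exp (θ * Complex.I))) 0 0‖ ^ 2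
        = (‖Tq q A B (Complex.exp (θ * Complex.I)) 0 0‖ ^ 2)⁻¹ := by
      rw [norm_div]
      field_simp
      linarith
    rw [h7, Real.log_inv, Real.log_pow]
    push_cast
    ring
  have hsum : ∑' k : ℤ, Real.log (1 - ‖q k‖ ^ 2)
      = (((Finset.Icc A B).sort (· ≤ ·)).map (fun k => Real.log (1 - ‖q k‖ ^ 2))).sum := by
    rw [tsum_eq_sum (s := Finset.Icc A B)]
    · rw [Finset.sum, ← Multiset.sum_coe, ← Multiset.map_coe, Finset.sort_eq]
    · intro k hk
      have : q k = 0 := by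
        by_contra h
        exact hk (Finset.mem_Icc.2 (hsupp k h))
      simp [this]
  simp_rw [hint]
  rw [intervalIntegral.integral_const_mul, hsum]
  rw [Real.circleAverage_def, smul_eq_mul] at hmean
  rw [halog] at hmean
  linear_combination (-2) * hmean
end
end

section
/- Let ℓ ∈ ℕ and let q : ℤ → ℂ satisfy |q(k)| < 1 for all k and q(k) = 0 for k outside [0,ℓ]. Let a(z) = (T_q(z))₁₁ and 𝔟(z) = (T_q(z))₂₁ (bottom-left entry) for z ≠ 0. Suppose F : 𝔻 → ℂ is analytic with |F(z)| ≤ 1 for all z ∈ 𝔻 and F(z)·a(z) = 𝔟(z) for all z ∈ 𝔻 with z ≠ 0, and suppose (F_k)_{k≥0} is a Schur chain with base function F_0 = F. Then F_k(0) = q(k) for every k ∈ ℕ. -/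
open Complex Metric Finset Filter

noncomputable section

/-- A Schur chain: each `F k` is analytic on the open unit disc, bounded by `1` there,
`‖F k 0‖ < 1`, and the Schur algorithm recursion holds. -/
def IsSchurChain (F : ℕ → ℂ → ℂ) : Prop :=
  ∀ k : ℕ,
    DifferentiableOn ℂ (F k) (Metric.ball 0 1) ∧
    (∀ z ∈ Metric.ball (0 : ℂ) 1, ‖F k z‖ ≤ 1) ∧
    ‖F k 0‖ < 1 ∧
    ∀ z ∈ Metric.ball (0 : ℂ) 1,
      z * F (k + 1) z * (1 - (starRingEnd ℂ) (F k 0) * F k z) = F k z - F k 0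

/-- The Szegő constant of a Schur chain: the limit (equivalently the infimum, since the
partial products are nonincreasing and lie in `[0,1]`) of `∏_{k<N} (1 - ‖F k 0‖²)`. -/
def szego (F : ℕ → ℂ → ℂ) : ℝ :=
  ⨅ N : ℕ, ∏ k ∈ Finset.range N, (1 - ‖F k 0‖ ^ 2)

/-- The constant `C(η, r)`. -/
def Cconst (η r : ℝ) : ℝ :=
  Real.exp (Real.log (1 / η) * (2 + 1 / (1 - Real.sqrt (1 - η))) * (4 / (1 - r) ^ 2 + 1))

/-- The normalised entries of the first column. -/
def colAB (q : ℤ → ℂ) (z : ℂ) : ℕ → ℕ → ℂ × ℂ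
  | 0, _ => (1, 0)
  | n + 1, j =>
    ((colAB q z n (j + 1)).1 + (starRingEnd ℂ) (q j) * z * (colAB q z n (j + 1)).2,
      q j * (colAB q z n (j + 1)).1 + z * (colAB q z n (j + 1)).2)

theorem colAB_cont (q : ℤ → ℂ) (n : ℕ) : ∀ j : ℕ,
    Continuous (fun z => (colAB q z n j).1) ∧ Continuous (fun z => (colAB q z n j).2) := by
  induction n with
  | zero => intro j; simp only [colAB]; exact ⟨continuous_const, continuous_const⟩
  | succ n ih =>
    intro j
    obtain ⟨h1, h2⟩ := ih (j + 1)
    simp only [colAB]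
    constructor <;> fun_prop

theorem colAB_zero (q : ℤ → ℂ) (n : ℕ) : ∀ j : ℕ, (colAB q 0 n j).1 = 1 := by
  induction n with
  | zero => intro j; rfl
  | succ n ih => intro j; simp [colAB, ih]

theorem prod_col (q : ℤ → ℂ) (hq : ∀ k : ℤ, ‖q k‖ < 1) (z : ℂ) (hz : z ≠ 0) (n : ℕ) :
    ∀ j : ℕ, ∃ c : ℂ, c ≠ 0 ∧
      ((((List.range' j n).map (fun k : ℕ => (k : ℤ))).map (transferFactor q z)).prod 0 0
        = c * (colAB q z n j).1) ∧
      ((((List.range' j n).map (fun k : ℕ => (k : ℤ))).map (transferFactor q z)).prod 1 0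
        = c * (z ^ j * (colAB q z n j).2)) := by
  induction n with
  | zero => intro j; exact ⟨1, one_ne_zero, by simp [colAB], by simp [colAB]⟩
  | succ n ih =>
    intro j
    obtain ⟨c, hc, h1, h2⟩ := ih (j + 1)
    have hs : (0 : ℝ) < Real.sqrt (1 - ‖q j‖ ^ 2) := by
      apply Real.sqrt_pos.mpr
      have := hq j
      have := norm_nonneg (q j)
      nlinarith
    refine ⟨((Real.sqrt (1 - ‖q j‖ ^ 2))⁻¹ : ℝ) * c, ?_, ?_, ?_⟩
    · refine mul_ne_zero ?_ hc
      exact_mod_cast (inv_pos.mpr hs).ne'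
    · rw [List.range'_succ, List.map_cons, List.map_cons, List.prod_cons, Matrix.mul_apply,
        Fin.sum_univ_two, h1, h2]
      simp only [transferFactor, colAB, Matrix.smul_apply, Matrix.of_apply, Matrix.cons_val',
        Matrix.cons_val_zero, Matrix.cons_val_one, Complex.real_smul, zpow_neg, zpow_natCast,
        Matrix.cons_val_fin_one]
      field_simp
      ring
    · rw [List.range'_succ, List.map_cons, List.map_cons, List.prod_cons, Matrix.mul_apply,
        Fin.sum_univ_two, h1, h2]
      simp only [transferFactor, colAB, Matrix.smul_apply, Matrix.of_apply, Matrix.cons_val',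
        Matrix.cons_val_zero, Matrix.cons_val_one, Complex.real_smul, zpow_neg, zpow_natCast,
        Matrix.cons_val_fin_one]
      ring

theorem sort_eq_range (ℓ : ℕ) : (Finset.Icc (0 : ℤ) ℓ).sort (· ≤ ·)
    = (List.range' 0 (ℓ + 1)).map (fun k : ℕ => (k : ℤ)) := by
  have hnd : ((List.range' 0 (ℓ + 1)).map (fun k : ℕ => (k : ℤ))).Nodup :=
    List.Nodup.map Nat.cast_injective List.nodup_range'
  have hs : ((List.range' 0 (ℓ + 1)).map (fun k : ℕ => (k : ℤ))).Pairwise (· ≤ ·) := by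
    rw [List.pairwise_map]
    exact (List.pairwise_le_range' (s := 0) (n := ℓ + 1)).imp (fun h => by exact_mod_cast h)
  have h := (List.toFinset_sort (· ≤ ·) hnd).mpr hs
  rw [← h]
  congr 1
  ext x
  simp only [Finset.mem_Icc, List.mem_toFinset, List.mem_map, List.mem_range'_1]
  constructor
  · rintro ⟨h0, h1⟩
    exact ⟨x.toNat, by omega, by omega⟩
  · rintro ⟨a, ha, rfl⟩
    omega

theorem schur_step (G : ℕ → ℂ → ℂ) (hG : IsSchurChain G) (p : ℂ) (hp : ‖p‖ < 1)
    (A B : ℂ → ℂ) (hA : Continuous A) (hB : Continuous B) (hA0 : A 0 = 1)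
    (h : ∀ z ∈ Metric.ball (0 : ℂ) 1, z ≠ 0 →
      G 0 z * (A z + (starRingEnd ℂ) p * z * B z) = p * A z + z * B z) :
    G 0 0 = p ∧ ∀ z ∈ Metric.ball (0 : ℂ) 1, z ≠ 0 → G 1 z * A z = B z := by
  obtain ⟨hd, -, -, hrec⟩ := hG 0
  have hball : Metric.ball (0 : ℂ) 1 ∈ nhds (0 : ℂ) := Metric.ball_mem_nhds _ one_pos
  have hc : ContinuousAt (G 0) 0 := (hd.differentiableAt hball).continuousAt
  have h00 : G 0 0 = p := by
    have hl : ContinuousAt (fun z => G 0 z * (A z + (starRingEnd ℂ) p * z * B z)) 0 :=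
      hc.mul (by fun_prop)
    have hr : ContinuousAt (fun z => p * A z + z * B z) 0 := by fun_prop
    have he : (fun z => G 0 z * (A z + (starRingEnd ℂ) p * z * B z))
        =ᶠ[nhdsWithin 0 {0}ᶜ] (fun z => p * A z + z * B z) := by
      filter_upwards [mem_nhdsWithin_of_mem_nhds hball, self_mem_nhdsWithin] with z hz hz0
      exact h z hz hz0
    have := tendsto_nhds_unique
      ((hl.tendsto.mono_left nhdsWithin_le_nhds).congr' he)
      (hr.tendsto.mono_left nhdsWithin_le_nhds)
    simpa [hA0] using this
  refine ⟨h00, fun z hz hz0 => ?_⟩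
  have h1 := hrec z hz
  have h2 := h z hz hz0
  rw [h00] at h1
  have hne : (1 - (starRingEnd ℂ) p * p) ≠ 0 := by
    rw [Complex.conj_mul']
    have : (0 : ℝ) < 1 - ‖p‖ ^ 2 := by nlinarith [norm_nonneg p]
    exact_mod_cast this.ne'
  apply mul_left_cancel₀ (mul_ne_zero hz0 hne)
  simp only [zero_add] at h1
  linear_combination (A z + (starRingEnd ℂ) p * z * B z) * h1
    + (1 + z * G 1 z * (starRingEnd ℂ) p) * h2

theorem schur_main (q : ℤ → ℂ) (hq : ∀ k : ℤ, ‖q k‖ < 1) (k : ℕ) :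
    ∀ (n j : ℕ) (G : ℕ → ℂ → ℂ), IsSchurChain G →
      (∀ i : ℕ, j + n ≤ i → q i = 0) →
      (∀ z ∈ Metric.ball (0 : ℂ) 1, z ≠ 0 →
        G 0 z * (colAB q z n j).1 = (colAB q z n j).2) →
      G k 0 = q ((j + k : ℕ) : ℤ) := by
  have key : ∀ (n j : ℕ) (G : ℕ → ℂ → ℂ), IsSchurChain G →
      (∀ i : ℕ, j + n ≤ i → q i = 0) →
      (∀ z ∈ Metric.ball (0 : ℂ) 1, z ≠ 0 →
        G 0 z * (colAB q z n j).1 = (colAB q z n j).2) →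
      G 0 0 = q j ∧ ∀ z ∈ Metric.ball (0 : ℂ) 1, z ≠ 0 →
        G 1 z * (colAB q z (n - 1) (j + 1)).1 = (colAB q z (n - 1) (j + 1)).2 := by
    intro n j G hG h0 h
    apply schur_step G hG (q j) (hq j) _ _ (colAB_cont q (n - 1) (j + 1)).1
      (colAB_cont q (n - 1) (j + 1)).2 (colAB_zero q _ _)
    intro z hz hz0
    have := h z hz hz0
    cases n with
    | zero =>
      have hqj : q j = 0 := h0 j (by omega)
      simpa [colAB, hqj] using this
    | succ n => simpa [colAB] using this
  induction k with
  | zero => intro n j G hG h0 h; exact (key n j G hG h0 h).1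
  | succ k ih =>
    intro n j G hG h0 h
    have := ih (n - 1) (j + 1) (fun i => G (i + 1)) (fun i => hG (i + 1))
      (fun i hi => h0 i (by omega)) (key n j G hG h0 h).2
    rw [show j + (k + 1) = j + 1 + k by omega]
    exact this


theorem stmt19 (ℓ : ℕ) (q : ℤ → ℂ) (hq : ∀ k : ℤ, ‖q k‖ < 1)
    (hsupp : ∀ k : ℤ, k < 0 ∨ (ℓ : ℤ) < k → q k = 0)
    (F : ℕ → ℂ → ℂ) (hF : IsSchurChain F)
    (hFeq : ∀ z ∈ Metric.ball (0 : ℂ) 1, z ≠ 0 →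
      F 0 z * (Tq q 0 (ℓ : ℤ) z) 0 0 = (Tq q 0 (ℓ : ℤ) z) 1 0) :
    ∀ k : ℕ, F k 0 = q (k : ℤ) := by
  intro k
  have := schur_main q hq k (ℓ + 1) 0 F hF
    (fun i hi => hsupp i (Or.inr (by omega))) ?_
  · simpa using this
  · intro z hz hz0
    obtain ⟨c, hc, h1, h2⟩ := prod_col q hq z hz0 (ℓ + 1) 0
    have h := hFeq z hz hz0
    rw [Tq, sort_eq_range, h1, h2] at h
    apply mul_left_cancel₀ hc
    linear_combination h
end
end
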